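/- arXiv:math/9803123 — 3 statements merged into one kernel-verified Lean document; each statement's English description precedes it below -/
import Mathlib

section
/- Let X be a type, let f : X → X be an injective map, and let C be a finite subset of X. Then C contains an f-orbit (i.e., there exists a nonempty subset C₁ ⊆ C with f(C₁) = C₁) if and only if there exists c ∈ C such that f^{i}(c) ∈ C for every i ≥ 0. -/
/-- For an injective map `f` and a finite set `C`, `C` contains an `f`-orbit
(a nonempty `C₁ ⊆ C` with `f '' C₁ = C₁`) iff some `c ∈ C` has its whole
forward orbit inside `C`. -/
theorem orbit_iff_forward_orbit_in_finite {X : Type*} (f : X → X)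
    (hf : Function.Injective f) {C : Set X} (hC : C.Finite) :
    (∃ C₁ : Set X, C₁.Nonempty ∧ C₁ ⊆ C ∧ f '' C₁ = C₁) ↔
      ∃ c ∈ C, ∀ i : ℕ, f^[i] c ∈ C := by
  constructor
  · rintro ⟨C₁, ⟨c, hc⟩, hsub, himg⟩
    have hmaps : Set.MapsTo f C₁ C₁ := Set.mapsTo_iff_image_subset.mpr himg.subset
    exact ⟨c, hsub hc, fun i => hsub (hmaps.iterate i hc)⟩
  · rintro ⟨c, -, hc⟩
    have hsub : Set.range (fun i : ℕ => f^[i] c) ⊆ C := Set.range_subset_iff.mpr hc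
    refine ⟨_, Set.range_nonempty _, hsub, ?_⟩
    refine Set.eq_of_subset_of_ncard_le ?_ (Set.ncard_image_of_injective _ hf).ge
      (hC.subset hsub)
    rintro _ ⟨_, ⟨i, rfl⟩, rfl⟩
    exact ⟨i + 1, Function.iterate_succ_apply' f i c⟩
end

section
/- Let X be a type, let f : X → X be an injective map, and let C be a finite subset of X that contains no f-orbit (there is no nonempty C₁ ⊆ C with f(C₁) = C₁). Let R be the equivalence relation on C generated by the relation relating x to y whenever x, y ∈ C and f(x) = y. Then every equivalence class of R is a finite chain: for each class E there exist c₀ ∈ C and n ≥ 0 such that E = { f^{i}(c₀) : 0 ≤ i ≤ n }, the elements f^{0}(c₀), f^{1}(c₀), …, f^{n}(c₀) are pairwise distinct and all lie in C, f^{n+1}(c₀) ∉ C, and there is no x ∈ C with f(x) = c₀. -/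
open Function Relation

section FiniteChains

variable {X : Type*} {f : X → X} {C : Set X}

/-- A finite set without `f`-orbits contains no complete forward trajectory. -/
theorem exists_iterate_notMem (hf : Injective f) (hC : C.Finite)
    (hno : ¬ ∃ C₁ : Set X, C₁.Nonempty ∧ C₁ ⊆ C ∧ f '' C₁ = C₁) (x : X) :
    ∃ n, f^[n] x ∉ C := by
  by_contra! h
  have hsub : Set.range (fun n => f^[n] x) ⊆ C := by
    rintro _ ⟨n, rfl⟩
    exact h n
  refine hno ⟨_, Set.range_nonempty _, hsub, ?_⟩
  refine Set.eq_of_subset_of_ncard_le ?_ (Set.ncard_image_of_injective _ hf).ge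
    (hC.subset hsub)
  rintro _ ⟨_, ⟨n, rfl⟩, rfl⟩
  exact ⟨n + 1, iterate_succ_apply' f n x⟩

/-- In a finite set without `f`-orbits, every element is reached, inside the set, from an element
that has no preimage in the set. -/
theorem exists_source_iterate_eq (hf : Injective f) (hC : C.Finite)
    (hno : ¬ ∃ C₁ : Set X, C₁.Nonempty ∧ C₁ ⊆ C ∧ f '' C₁ = C₁) {c : X} (hc : c ∈ C) :
    ∃ c₀, (∃ i, f^[i] c₀ = c ∧ ∀ j ≤ i, f^[j] c₀ ∈ C) ∧ ¬ ∃ x ∈ C, f x = c₀ := by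
  by_contra! h
  let B : Set X := {x | ∃ i, f^[i] x = c ∧ ∀ j ≤ i, f^[j] x ∈ C}
  have hsub : B ⊆ C := fun x ⟨i, _, hi⟩ => hi 0 i.zero_le
  have hfin : B.Finite := hC.subset hsub
  refine hno ⟨B, ⟨c, 0, rfl, fun j hj => by simpa [Nat.le_zero.mp hj] using hc⟩, hsub, ?_⟩
  refine (Set.eq_of_subset_of_ncard_le ?_ (Set.ncard_image_of_injective _ hf).le
    (hfin.image f)).symm
  rintro y hy
  obtain ⟨x, hx, rfl⟩ := h y hy
  obtain ⟨i, hi, hj⟩ := hy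
  refine ⟨x, ⟨i + 1, hi, fun j hji => ?_⟩, rfl⟩
  cases j with
  | zero => exact hx
  | succ k => exact hj k (by omega)

/-- The forward iterates of a point without preimage in `C` are pairwise distinct as long as they
stay in `C`. -/
theorem eq_of_iterate_eq_of_source (hf : Injective f) {c₀ : X} {n : ℕ}
    (hmem : ∀ i ≤ n, f^[i] c₀ ∈ C) (hsrc : ¬ ∃ x ∈ C, f x = c₀) {i j : ℕ} (hi : i ≤ n)
    (hj : j ≤ n) (h : f^[i] c₀ = f^[j] c₀) : i = j := by
  wlog hij : i < j generalizing i j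
  · rcases (not_lt.mp hij).eq_or_lt with h' | h'
    · exact h'.symm
    · exact (this hj hi h.symm h').symm
  obtain ⟨k, rfl⟩ := Nat.exists_eq_add_of_lt hij
  rw [add_assoc, iterate_add_apply] at h
  have h' := hf.iterate i h
  rw [iterate_succ_apply'] at h'
  exact absurd ⟨_, hmem k (by omega), h'.symm⟩ hsrc

end FiniteChains

/-- For an injective map `f` and a finite set `C` containing no `f`-orbit,
every equivalence class of the equivalence relation on `C` generated by
`x ~ y` whenever `x, y ∈ C` and `f x = y` is a finite chain
`c₀, f c₀, …, f^[n] c₀` of pairwise distinct elements of `C`, with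
`f^[n+1] c₀ ∉ C` and no element of `C` mapping to `c₀`. -/
theorem eqv_classes_are_chains {X : Type*} (f : X → X)
    (hf : Function.Injective f) {C : Set X} (hC : C.Finite)
    (hno : ¬ ∃ C₁ : Set X, C₁.Nonempty ∧ C₁ ⊆ C ∧ f '' C₁ = C₁) :
    ∀ c ∈ C, ∃ c₀ ∈ C, ∃ n : ℕ,
      ({x | Relation.EqvGen (fun x y => x ∈ C ∧ y ∈ C ∧ f x = y) c x}
          = {x | ∃ i ≤ n, f^[i] c₀ = x}) ∧
      (∀ i ≤ n, f^[i] c₀ ∈ C) ∧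
      (∀ i ≤ n, ∀ j ≤ n, f^[i] c₀ = f^[j] c₀ → i = j) ∧
      f^[n + 1] c₀ ∉ C ∧
      ¬ ∃ x ∈ C, f x = c₀ := by
  intro c hc
  obtain ⟨c₀, ⟨i, hic, hi⟩, hsrc⟩ := exists_source_iterate_eq hf hC hno hc
  obtain ⟨n, hmem, hn⟩ : ∃ n, (∀ i ≤ n, f^[i] c₀ ∈ C) ∧ f^[n + 1] c₀ ∉ C := by
    by_contra! h
    obtain ⟨m, hm⟩ := exists_iterate_notMem hf hC hno c₀
    refine hm ?_
    induction m using Nat.strong_induction_on with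
    | _ m ih =>
      cases m with
      | zero => exact hi 0 i.zero_le
      | succ k =>
        refine h k fun l hl => ?_
        by_contra hl'
        exact hl' (ih l (by omega) hl')
  have hin : i ≤ n := by
    by_contra hlt
    exact hn (hi (n + 1) (by omega))
  have hgen : ∀ k ≤ n, EqvGen (fun x y => x ∈ C ∧ y ∈ C ∧ f x = y) c₀ (f^[k] c₀) := by
    intro k hk
    induction k with
    | zero => exact .refl _
    | succ k ih =>
      exact .trans _ _ _ (ih (by omega))
        (.rel _ _ ⟨hmem k (by omega), hmem _ hk, (iterate_succ_apply' f k c₀).symm⟩)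
  have hinv : ∀ x y, EqvGen (fun x y => x ∈ C ∧ y ∈ C ∧ f x = y) x y →
      ((∃ k ≤ n, f^[k] c₀ = x) ↔ ∃ k ≤ n, f^[k] c₀ = y) := by
    intro x y h
    induction h with
    | refl x => exact Iff.rfl
    | symm x y _ ih => exact ih.symm
    | trans x y z _ _ ih₁ ih₂ => exact ih₁.trans ih₂
    | rel x y h =>
      obtain ⟨hx, hy, rfl⟩ := h
      constructor
      · rintro ⟨k, hk, rfl⟩
        rw [← iterate_succ_apply' f] at hy ⊢
        refine ⟨k + 1, ?_, rfl⟩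
        by_contra hlt
        obtain rfl : k = n := by omega
        exact hn hy
      · rintro ⟨k, hk, h⟩
        cases k with
        | zero => exact absurd ⟨x, hx, h.symm⟩ hsrc
        | succ k => exact ⟨k, by omega, hf (by rwa [← iterate_succ_apply' f])⟩
  refine ⟨c₀, hmem 0 n.zero_le, n, ?_, hmem,
    fun i hi j hj h => eq_of_iterate_eq_of_source hf hmem hsrc hi hj h, hn, hsrc⟩
  ext x
  constructor
  · exact fun h => (hinv c x h).mp ⟨i, hin, hic⟩
  · rintro ⟨k, hk, rfl⟩
    exact .trans _ _ _ (.symm _ _ (hic ▸ hgen i hin)) (hgen k hk)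
end

section
/- Let v, w ∈ ℤ² be primitive vectors (i.e., the two coordinates of v are coprime, and likewise for w) with w ≠ v and w ≠ −v. Then there exists a matrix A ∈ SL(2, ℤ) with |trace(A)| > 2 such that A·v = w. -/
/-- Two primitive integer vectors with vanishing determinant agree up to sign. -/
theorem eq_or_eq_neg_of_primitive_of_det_eq_zero {v w : Fin 2 → ℤ}
    (hv : IsCoprime (v 0) (v 1)) (hw : IsCoprime (w 0) (w 1))
    (h : v 0 * w 1 - v 1 * w 0 = 0) : w = v ∨ w = -v := by
  obtain ⟨x, y, hxy⟩ := hv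
  obtain ⟨p, q, hpq⟩ := hw
  have h0 : w 0 = (x * w 0 + y * w 1) * v 0 := by
    linear_combination -w 0 * hxy - y * h
  have h1 : w 1 = (x * w 0 + y * w 1) * v 1 := by
    linear_combination -w 1 * hxy + x * h
  have hs : IsUnit (x * w 0 + y * w 1) :=
    IsUnit.of_mul_eq_one (p * v 0 + q * v 1) (by linear_combination hpq - p * h0 - q * h1)
  rcases Int.isUnit_iff.mp hs with hs | hs <;> simp only [hs, one_mul, neg_one_mul] at h0 h1
  · left
    ext i
    fin_cases i <;> assumption
  · right
    ext i
    fin_cases i <;> assumption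

/-- Given primitive vectors `v ≠ ±w` in `ℤ²`, there is a matrix in `SL(2, ℤ)`
with `|trace| > 2` taking `v` to `w`. -/
theorem exists_anosov_matrix_of_primitive {v w : Fin 2 → ℤ}
    (hv : IsCoprime (v 0) (v 1)) (hw : IsCoprime (w 0) (w 1))
    (hne : w ≠ v) (hne' : w ≠ -v) :
    ∃ A : Matrix.SpecialLinearGroup (Fin 2) ℤ,
      |Matrix.trace (A : Matrix (Fin 2) (Fin 2) ℤ)| > 2 ∧
      Matrix.mulVec (A : Matrix (Fin 2) (Fin 2) ℤ) v = w := by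
  have hdet : v 0 * w 1 - v 1 * w 0 ≠ 0 := fun h =>
    (eq_or_eq_neg_of_primitive_of_det_eq_zero hv hw h).elim hne hne'
  obtain ⟨x, y, hxy⟩ := hv
  obtain ⟨p, q, hpq⟩ := hw
  -- The matrices taking `v` to `w` form a family in `k` whose trace is affine with slope `det (v, w)`.
  obtain ⟨k, hk⟩ : ∃ k : ℤ, 2 < w 0 * x + w 1 * y + v 1 * q + v 0 * p +
      k * (v 0 * w 1 - v 1 * w 0) := by
    set t := w 0 * x + w 1 * y + v 1 * q + v 0 * p
    set d := v 0 * w 1 - v 1 * w 0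
    refine ⟨d * (|t| + 3), ?_⟩
    have hd : 0 < d ^ 2 := by positivity
    nlinarith [neg_abs_le t, abs_nonneg t]
  refine ⟨⟨!![w 0 * x - v 1 * (k * w 0 - q), w 0 * y + v 0 * (k * w 0 - q);
      w 1 * x - v 1 * (k * w 1 + p), w 1 * y + v 0 * (k * w 1 + p)], ?_⟩, ?_, ?_⟩
  · rw [Matrix.det_fin_two_of]
    linear_combination (p * w 0 + q * w 1) * hxy + hpq
  · refine lt_of_lt_of_le ?_ (le_abs_self _)
    rw [Matrix.trace_fin_two_of]
    linear_combination hk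
  · ext i
    fin_cases i
    · simp [Matrix.mulVec, dotProduct, Fin.sum_univ_two]
      linear_combination w 0 * hxy
    · simp [Matrix.mulVec, dotProduct, Fin.sum_univ_two]
      linear_combination w 1 * hxy
end
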